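/- arXiv:2011.11430 — 9 statements merged into one kernel-verified Lean document; each statement's English description precedes it below -/
import Mathlib

section
/- Let A, B, P̄, S, Ȧ, Ḃ, Ċ, Ṗ, P be n×n real matrices. Suppose the tangent equation A·Ṗ + Ṗ·B + Ȧ·P + P·Ḃ + Ċ = 0 holds and S solves the adjoint Sylvester equation Aᵀ·S + S·Bᵀ + P̄ = 0. Then tr(P̄ᵀ·Ṗ) = tr((S·Pᵀ)ᵀ·Ȧ) + tr((Pᵀ·S)ᵀ·Ḃ) + tr(Sᵀ·Ċ); that is, the reverse-mode adjoints Ā = S·Pᵀ, B̄ = Pᵀ·S, C̄ = S correctly reproduce the directional derivative of any scalar loss through the solution of the continuous-time Sylvester equation. -/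
open Matrix

/-- Reverse-mode correctness for the continuous-time Sylvester equation:
if the tangent equation `A*Ṗ + Ṗ*B + Ȧ*P + P*Ḃ + Ċ = 0` holds and `S` solves the
adjoint Sylvester equation `Aᵀ*S + S*Bᵀ + P̄ = 0`, then
`tr(P̄ᵀ*Ṗ) = tr((S*Pᵀ)ᵀ*Ȧ) + tr((Pᵀ*S)ᵀ*Ḃ) + tr(Sᵀ*Ċ)`, i.e. the adjoints
`Ā = S*Pᵀ`, `B̄ = Pᵀ*S`, `C̄ = S` reproduce the directional derivative. -/
theorem sylvester_continuous_reverse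
    {n : Type*} [Fintype n] [DecidableEq n]
    (A B Pbar S Adot Bdot Cdot Pdot P : Matrix n n ℝ)
    (htan : A * Pdot + Pdot * B + Adot * P + P * Bdot + Cdot = 0)
    (hadj : Aᵀ * S + S * Bᵀ + Pbar = 0) :
    (Pbarᵀ * Pdot).trace
      = ((S * Pᵀ)ᵀ * Adot).trace + ((Pᵀ * S)ᵀ * Bdot).trace + (Sᵀ * Cdot).trace := by
  have h1 := congrArg (fun M => (Sᵀ * M).trace) htan
  have h2 := congrArg (fun M => (Mᵀ * Pdot).trace) hadj
  simp only [Matrix.mul_add, Matrix.add_mul, Matrix.transpose_add, Matrix.transpose_mul,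
    Matrix.transpose_transpose, Matrix.trace_add, Matrix.mul_zero, Matrix.zero_mul,
    Matrix.transpose_zero, Matrix.trace_zero, Matrix.mul_assoc] at h1 h2 ⊢
  have e1 : (B * (Sᵀ * Pdot)).trace = (Sᵀ * (Pdot * B)).trace := by
    rw [Matrix.trace_mul_comm, Matrix.mul_assoc]
  have e2 : (P * (Sᵀ * Adot)).trace = (Sᵀ * (Adot * P)).trace := by
    rw [Matrix.trace_mul_comm, Matrix.mul_assoc]
  linarith
end

section
/- Let A, B, P̄, S, Ȧ, Ḃ, Ċ, Ṗ, P be n×n real matrices. Suppose the tangent equation A·Ṗ·B − Ṗ + Ȧ·P·B + A·P·Ḃ + Ċ = 0 holds and S solves the adjoint equation Aᵀ·S·Bᵀ − S + P̄ = 0. Then tr(P̄ᵀ·Ṗ) = tr((S·Bᵀ·Pᵀ)ᵀ·Ȧ) + tr((Pᵀ·Aᵀ·S)ᵀ·Ḃ) + tr(Sᵀ·Ċ); that is, the reverse-mode adjoints Ā = S·Bᵀ·Pᵀ, B̄ = Pᵀ·Aᵀ·S, C̄ = S correctly reproduce the directional derivative of any scalar loss through the solution of the discrete-time Sylvester equation.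 -/
open Matrix

/-- Reverse-mode correctness for the discrete-time Sylvester equation:
if the tangent equation `A*Ṗ*B - Ṗ + Ȧ*P*B + A*P*Ḃ + Ċ = 0` holds and `S` solves
the adjoint equation `Aᵀ*S*Bᵀ - S + P̄ = 0`, then
`tr(P̄ᵀ*Ṗ) = tr((S*Bᵀ*Pᵀ)ᵀ*Ȧ) + tr((Pᵀ*Aᵀ*S)ᵀ*Ḃ) + tr(Sᵀ*Ċ)`, i.e. the adjoints
`Ā = S*Bᵀ*Pᵀ`, `B̄ = Pᵀ*Aᵀ*S`, `C̄ = S` reproduce the directional derivative. -/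
theorem sylvester_discrete_reverse
    {n : Type*} [Fintype n] [DecidableEq n]
    (A B Pbar S Adot Bdot Cdot Pdot P : Matrix n n ℝ)
    (htan : A * Pdot * B - Pdot + Adot * P * B + A * P * Bdot + Cdot = 0)
    (hadj : Aᵀ * S * Bᵀ - S + Pbar = 0) :
    (Pbarᵀ * Pdot).trace
      = ((S * Bᵀ * Pᵀ)ᵀ * Adot).trace + ((Pᵀ * Aᵀ * S)ᵀ * Bdot).trace + (Sᵀ * Cdot).trace := by
  have hP : Pbar = S - Aᵀ * S * Bᵀ := by
    have h : Pbar - (S - Aᵀ * S * Bᵀ) = 0 := by rw [← hadj]; abel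
    exact sub_eq_zero.mp h
  have ht := congrArg (fun M => (Sᵀ * M).trace) htan
  simp only [Matrix.mul_add, Matrix.mul_sub, Matrix.trace_add, Matrix.trace_sub,
    Matrix.mul_zero, Matrix.trace_zero] at ht
  have h1 : (Sᵀ * (A * Pdot * B)).trace = (B * (Sᵀ * (A * Pdot))).trace := by
    rw [← Matrix.mul_assoc, Matrix.trace_mul_comm]
  have h2 : (Sᵀ * (Adot * P * B)).trace = (P * (B * (Sᵀ * Adot))).trace := by
    rw [← Matrix.mul_assoc P B, Matrix.trace_mul_comm (P * B)]
    simp only [Matrix.mul_assoc]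
  rw [h1, h2] at ht
  subst hP
  simp only [Matrix.transpose_sub, Matrix.transpose_mul, Matrix.transpose_transpose,
    Matrix.sub_mul, Matrix.trace_sub, Matrix.mul_assoc] at ht ⊢
  linarith
end

section
/- Let A, P, P̄, S, Ȧ, Q̇, Ṗ be n×n real matrices. Suppose the tangent equation A·Ṗ + Ṗ·Aᵀ + Ȧ·P + P·Ȧᵀ + Q̇ = 0 holds and S solves the adjoint Lyapunov equation Aᵀ·S + S·A + P̄ = 0. Then tr(P̄ᵀ·Ṗ) = tr((S·Pᵀ + Sᵀ·P)ᵀ·Ȧ) + tr(Sᵀ·Q̇); that is, the reverse-mode adjoints Ā = S·Pᵀ + Sᵀ·P and Q̄ = S correctly reproduce the directional derivative of any scalar loss through the solution of the continuous-time Lyapunov equation. -/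
open Matrix

/-- Reverse-mode correctness for the continuous-time Lyapunov equation:
if the tangent equation `A*Ṗ + Ṗ*Aᵀ + Ȧ*P + P*Ȧᵀ + Q̇ = 0` holds and `S` solves
the adjoint Lyapunov equation `Aᵀ*S + S*A + P̄ = 0`, then
`tr(P̄ᵀ*Ṗ) = tr((S*Pᵀ + Sᵀ*P)ᵀ*Ȧ) + tr(Sᵀ*Q̇)`, i.e. the adjoints
`Ā = S*Pᵀ + Sᵀ*P` and `Q̄ = S` reproduce the directional derivative. -/
theorem lyapunov_continuous_reverse
    {n : Type*} [Fintype n] [DecidableEq n]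
    (A P Pbar S Adot Qdot Pdot : Matrix n n ℝ)
    (htan : A * Pdot + Pdot * Aᵀ + Adot * P + P * Adotᵀ + Qdot = 0)
    (hadj : Aᵀ * S + S * A + Pbar = 0) :
    (Pbarᵀ * Pdot).trace
      = ((S * Pᵀ + Sᵀ * P)ᵀ * Adot).trace + (Sᵀ * Qdot).trace := by
  have h1 := congrArg (fun M => (Sᵀ * M).trace) htan
  have h2 := congrArg (fun M => (Mᵀ * Pdot).trace) hadj
  simp only [Matrix.mul_add, Matrix.add_mul, transpose_add, transpose_mul, transpose_transpose,
    trace_add, Matrix.mul_zero, Matrix.zero_mul, transpose_zero, trace_zero] at h1 h2 ⊢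
  have e1 : (Sᵀ * (Pdot * Aᵀ)).trace = (Aᵀ * Sᵀ * Pdot).trace := by
    rw [← Matrix.mul_assoc, Matrix.trace_mul_comm, Matrix.mul_assoc]
  have e2 : (Sᵀ * (Adot * P)).trace = (P * Sᵀ * Adot).trace := by
    rw [← Matrix.mul_assoc, Matrix.trace_mul_comm, Matrix.mul_assoc]
  have e3 : (Sᵀ * (P * Adotᵀ)).trace = (Pᵀ * S * Adot).trace := by
    rw [← Matrix.trace_transpose]
    simp only [transpose_mul, transpose_transpose]
    rw [Matrix.mul_assoc, Matrix.trace_mul_comm]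
  have e4 : (Sᵀ * (A * Pdot)).trace = (Sᵀ * A * Pdot).trace := by
    rw [Matrix.mul_assoc]
  linarith
end

section
/- Let A, P, P̄, S, Ȧ, Q̇, Ṗ be n×n real matrices. Suppose the tangent equation A·Ṗ·Aᵀ − Ṗ + Ȧ·P·Aᵀ + A·P·Ȧᵀ + Q̇ = 0 holds and S solves the adjoint equation Aᵀ·S·A − S + P̄ = 0. Then tr(P̄ᵀ·Ṗ) = tr((S·A·Pᵀ + Sᵀ·A·P)ᵀ·Ȧ) + tr(Sᵀ·Q̇); that is, the reverse-mode adjoints Ā = S·A·Pᵀ + Sᵀ·A·P and Q̄ = S correctly reproduce the directional derivative of any scalar loss through the solution of the discrete-time Lyapunov equation. -/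
open Matrix

/-- Reverse-mode correctness for the discrete-time Lyapunov equation:
if the tangent equation `A*Ṗ*Aᵀ - Ṗ + Ȧ*P*Aᵀ + A*P*Ȧᵀ + Q̇ = 0` holds and `S`
solves the adjoint equation `Aᵀ*S*A - S + P̄ = 0`, then
`tr(P̄ᵀ*Ṗ) = tr((S*A*Pᵀ + Sᵀ*A*P)ᵀ*Ȧ) + tr(Sᵀ*Q̇)`, i.e. the adjoints
`Ā = S*A*Pᵀ + Sᵀ*A*P` and `Q̄ = S` reproduce the directional derivative. -/
theorem lyapunov_discrete_reverse
    {n : Type*} [Fintype n] [DecidableEq n]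
    (A P Pbar S Adot Qdot Pdot : Matrix n n ℝ)
    (htan : A * Pdot * Aᵀ - Pdot + Adot * P * Aᵀ + A * P * Adotᵀ + Qdot = 0)
    (hadj : Aᵀ * S * A - S + Pbar = 0) :
    (Pbarᵀ * Pdot).trace
      = ((S * A * Pᵀ + Sᵀ * A * P)ᵀ * Adot).trace + (Sᵀ * Qdot).trace := by
  have hP : Pbar = S - Aᵀ * S * A := by
    rw [← sub_eq_zero, ← hadj]; abel
  have h := congrArg (fun M => (Sᵀ * M).trace) htan
  simp only [Matrix.mul_add, Matrix.mul_sub, trace_add, trace_sub, Matrix.mul_zero, trace_zero] at h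
  have h1 : (Sᵀ * (A * Pdot * Aᵀ)).trace = (Aᵀ * (Sᵀ * A) * Pdot).trace := by
    rw [← Matrix.mul_assoc, trace_mul_comm]
    simp only [Matrix.mul_assoc]
  have h2 : (Sᵀ * (Adot * P * Aᵀ)).trace = (P * (Aᵀ * Sᵀ) * Adot).trace := by
    have : Sᵀ * (Adot * P * Aᵀ) = (Sᵀ * Adot) * (P * Aᵀ) := by
      simp only [Matrix.mul_assoc]
    rw [this, trace_mul_comm]
    simp only [Matrix.mul_assoc]
  have h3 : (Sᵀ * (A * P * Adotᵀ)).trace = (Pᵀ * (Aᵀ * S) * Adot).trace := by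
    rw [← trace_transpose (Pᵀ * (Aᵀ * S) * Adot), ← Matrix.mul_assoc, trace_mul_comm]
    simp only [transpose_mul, transpose_transpose, Matrix.mul_assoc]
  rw [h1, h2, h3] at h
  rw [hP]
  simp only [transpose_sub, transpose_add, transpose_mul, transpose_transpose, Matrix.sub_mul,
    Matrix.add_mul, trace_add, trace_sub]
  linarith
end

section
/- Let A, B, P, P̄, S, Ȧ, Ḃ, Q̇, Ṙ, Ṗ, K be n×n real matrices with P, S, P̄, Ṙ symmetric. Set Ã = A − B·K and Ż = P·(Ȧ − Ḃ·K). Suppose the tangent equation Ṗ·Ã + Ãᵀ·Ṗ + Ż + Żᵀ + Q̇ + Kᵀ·Ṙ·K = 0 holds and S solves the adjoint Lyapunov equation Ã·S + S·Ãᵀ + P̄ = 0. Then tr(P̄·Ṗ) = tr((2·P·S)ᵀ·Ȧ) + tr((−2·P·S·Kᵀ)ᵀ·Ḃ) + tr(S·Q̇) + tr((K·S·Kᵀ)·Ṙ); that is, the reverse-mode adjoints Ā = 2·P·S, B̄ = −2·P·S·Kᵀ, Q̄ = S, R̄ = K·S·Kᵀ correctly reproduce the directional derivative of any scalar loss through the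 solution of the continuous-time algebraic Riccati equation. -/
open Matrix

/-- Reverse-mode correctness for the continuous-time algebraic Riccati equation (CARE):
with `P, S, P̄, Ṙ` symmetric, `Ã = A - B*K`, `Ż = P*(Ȧ - Ḃ*K)`, if the tangent equation
`Ṗ*Ã + Ãᵀ*Ṗ + Ż + Żᵀ + Q̇ + Kᵀ*Ṙ*K = 0` holds and `S` solves the adjoint Lyapunov
equation `Ã*S + S*Ãᵀ + P̄ = 0`, then
`tr(P̄*Ṗ) = tr((2*P*S)ᵀ*Ȧ) + tr((-2*P*S*Kᵀ)ᵀ*Ḃ) + tr(S*Q̇) + tr((K*S*Kᵀ)*Ṙ)`,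
i.e. the adjoints `Ā = 2*P*S`, `B̄ = -2*P*S*Kᵀ`, `Q̄ = S`, `R̄ = K*S*Kᵀ` reproduce the
directional derivative. -/
theorem care_reverse
    {n : Type*} [Fintype n] [DecidableEq n]
    (A B P Pbar S Adot Bdot Qdot Rdot Pdot K : Matrix n n ℝ)
    (hP : P.IsSymm) (hS : S.IsSymm) (hPbar : Pbar.IsSymm) (hRdot : Rdot.IsSymm) :
    ∀ Atil Zdot : Matrix n n ℝ,
      Atil = A - B * K →
      Zdot = P * (Adot - Bdot * K) →
      Pdot * Atil + Atilᵀ * Pdot + Zdot + Zdotᵀ + Qdot + Kᵀ * Rdot * K = 0 →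
      Atil * S + S * Atilᵀ + Pbar = 0 →
      (Pbar * Pdot).trace
        = ((2 • (P * S))ᵀ * Adot).trace + ((-(2 • (P * S * Kᵀ)))ᵀ * Bdot).trace
          + (S * Qdot).trace + ((K * S * Kᵀ) * Rdot).trace := by
  intro Atil Zdot _ hZ hT hL
  have h1 := congrArg (fun M => (S * M).trace) hT
  have h2 := congrArg (fun M => (M * Pdot).trace) hL
  simp only [Matrix.mul_add, Matrix.add_mul, Matrix.trace_add, Matrix.mul_zero,
    Matrix.zero_mul, Matrix.trace_zero] at h1 h2
  have e1 : (S * (Pdot * Atil)).trace = (Atil * S * Pdot).trace := by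
    rw [← Matrix.mul_assoc, Matrix.trace_mul_comm, Matrix.mul_assoc]
  have e2 : (S * (Atilᵀ * Pdot)).trace = (S * Atilᵀ * Pdot).trace := by
    rw [Matrix.mul_assoc]
  have e3 : (S * Zdotᵀ).trace = (S * Zdot).trace := by
    rw [← Matrix.trace_transpose, Matrix.transpose_mul, Matrix.transpose_transpose, hS.eq,
      Matrix.trace_mul_comm]
  have e4 : (S * (Kᵀ * Rdot * K)).trace = (K * S * Kᵀ * Rdot).trace := by
    rw [← Matrix.mul_assoc, Matrix.trace_mul_comm]
    simp only [Matrix.mul_assoc]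
  have e5 : (S * Zdot).trace = (S * P * Adot).trace - (K * S * P * Bdot).trace := by
    have e6 : (K * S * P * Bdot).trace = (S * P * Bdot * K).trace := by
      rw [Matrix.trace_mul_comm (S * P * Bdot) K]
      simp only [Matrix.mul_assoc]
    rw [e6, hZ, Matrix.mul_sub, Matrix.mul_sub, Matrix.trace_sub]
    simp only [Matrix.mul_assoc]
  have e7 : ((2 • (P * S))ᵀ * Adot).trace = 2 * (S * P * Adot).trace := by
    rw [Matrix.transpose_smul, Matrix.transpose_mul, hS.eq, hP.eq, Matrix.smul_mul,
      Matrix.trace_smul]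
    simp
  have e8 : ((-(2 • (P * S * Kᵀ)))ᵀ * Bdot).trace = -(2 * (K * S * P * Bdot).trace) := by
    rw [Matrix.transpose_neg, Matrix.transpose_smul, Matrix.transpose_mul, Matrix.transpose_mul,
      hS.eq, hP.eq, Matrix.transpose_transpose, Matrix.neg_mul, Matrix.smul_mul,
      Matrix.trace_neg, Matrix.trace_smul, ← Matrix.mul_assoc]
    simp
  rw [e7, e8]
  linarith
end

section
/- Let A, B, P, P̄, S, Ȧ, Ḃ, Q̇, Ṙ, Ṗ, K be n×n real matrices with P, S, P̄, Ṙ symmetric. Set Ã = A − B·K and Ż = Ãᵀ·P·(Ȧ − Ḃ·K). Suppose the tangent equation Ãᵀ·Ṗ·Ã − Ṗ + Ż + Żᵀ + Q̇ + Kᵀ·Ṙ·K = 0 holds and S solves the adjoint discrete-time Lyapunov equation Ã·S·Ãᵀ − S + P̄ = 0. Then tr(P̄·Ṗ) = tr((2·P·Ã·S)ᵀ·Ȧ) + tr((−2·P·Ã·S·Kᵀ)ᵀ·Ḃ) + tr(S·Q̇) + tr((K·S·Kᵀ)·Ṙ); that is, the reverse-mode adjoints Ā = 2·P·Ã·S,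 B̄ = −2·P·Ã·S·Kᵀ, Q̄ = S, R̄ = K·S·Kᵀ correctly reproduce the directional derivative of any scalar loss through the solution of the discrete-time algebraic Riccati equation. -/
open Matrix

/-- Reverse-mode correctness for the discrete-time algebraic Riccati equation (DARE):
with `P, S, P̄, Ṙ` symmetric, `Ã = A - B*K`, `Ż = Ãᵀ*P*(Ȧ - Ḃ*K)`, if the tangent
equation `Ãᵀ*Ṗ*Ã - Ṗ + Ż + Żᵀ + Q̇ + Kᵀ*Ṙ*K = 0` holds and `S` solves the adjoint
discrete-time Lyapunov equation `Ã*S*Ãᵀ - S + P̄ = 0`, then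
`tr(P̄*Ṗ) = tr((2*P*Ã*S)ᵀ*Ȧ) + tr((-2*P*Ã*S*Kᵀ)ᵀ*Ḃ) + tr(S*Q̇) + tr((K*S*Kᵀ)*Ṙ)`,
i.e. the adjoints `Ā = 2*P*Ã*S`, `B̄ = -2*P*Ã*S*Kᵀ`, `Q̄ = S`, `R̄ = K*S*Kᵀ` reproduce
the directional derivative. -/
theorem dare_reverse
    {n : Type*} [Fintype n] [DecidableEq n]
    (A B P Pbar S Adot Bdot Qdot Rdot Pdot K : Matrix n n ℝ)
    (hP : P.IsSymm) (hS : S.IsSymm) (hPbar : Pbar.IsSymm) (hRdot : Rdot.IsSymm) :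
    ∀ Atil Zdot : Matrix n n ℝ,
      Atil = A - B * K →
      Zdot = Atilᵀ * P * (Adot - Bdot * K) →
      Atilᵀ * Pdot * Atil - Pdot + Zdot + Zdotᵀ + Qdot + Kᵀ * Rdot * K = 0 →
      Atil * S * Atilᵀ - S + Pbar = 0 →
      (Pbar * Pdot).trace
        = ((2 • (P * Atil * S))ᵀ * Adot).trace + ((-(2 • (P * Atil * S * Kᵀ)))ᵀ * Bdot).trace
          + (S * Qdot).trace + ((K * S * Kᵀ) * Rdot).trace := by
  intro T Z _ hZ h1 h2
  have e1 : (S * (Tᵀ * Pdot * T - Pdot + Z + Zᵀ + Qdot + Kᵀ * Rdot * K)).trace = 0 := by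
    rw [h1]; simp
  have e2 : ((T * S * Tᵀ - S + Pbar) * Pdot).trace = 0 := by
    rw [h2]; simp
  simp only [mul_add, mul_sub, add_mul, sub_mul, trace_add, trace_sub] at e1 e2
  have a1 : (S * (Tᵀ * Pdot * T)).trace = (T * S * Tᵀ * Pdot).trace := by
    rw [← Matrix.mul_assoc, trace_mul_comm]
    simp only [Matrix.mul_assoc]
  have a2 : (S * Zᵀ).trace = (S * Z).trace := by
    rw [← trace_transpose, transpose_mul, transpose_transpose, hS.eq, trace_mul_comm]
  have a3 : (S * (Kᵀ * Rdot * K)).trace = (K * S * Kᵀ * Rdot).trace := by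
    rw [← Matrix.mul_assoc, trace_mul_comm]
    simp only [Matrix.mul_assoc]
  have a4 : (S * Z).trace = (S * Tᵀ * P * Adot).trace - (K * S * Tᵀ * P * Bdot).trace := by
    have : (K * S * Tᵀ * P * Bdot).trace = (S * Tᵀ * P * Bdot * K).trace := by
      rw [trace_mul_comm (S * Tᵀ * P * Bdot) K]
      simp only [Matrix.mul_assoc]
    rw [this, hZ, ← trace_sub]
    simp only [mul_sub, Matrix.mul_assoc]
  have a5 : ((2 • (P * T * S))ᵀ * Adot).trace = 2 * (S * Tᵀ * P * Adot).trace := by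
    simp only [two_smul, transpose_neg, transpose_add, transpose_mul, transpose_transpose, hS.eq, hP.eq,
      Matrix.mul_assoc, neg_mul, add_mul, trace_neg, trace_add, two_mul]
  have a6 : ((-(2 • (P * T * S * Kᵀ)))ᵀ * Bdot).trace = -(2 * (K * S * Tᵀ * P * Bdot).trace) := by
    simp only [two_smul, transpose_neg, transpose_add, transpose_mul, transpose_transpose, hS.eq, hP.eq,
      Matrix.mul_assoc, neg_mul, add_mul, trace_neg, trace_add, two_mul]
  rw [a5, a6]
  linarith
end

section
/- Let A and B be n×n complex matrices. The linear map on n×n complex matrices given by P ↦ A·P + P·B is bijective (equivalently, for every C the continuous-time Sylvester equation A·P + P·B + C = 0 has a unique solution P) if and only if for every eigenvalue μ in the spectrum of A and every eigenvalue ν in the spectrum of B one has μ + ν ≠ 0, i.e., A and −B have no common eigenvalue. -/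
open Matrix

/-- The continuous-time Sylvester operator `P ↦ A*P + P*B` on `n × n` complex matrices
is bijective (i.e. `A*P + P*B + C = 0` has a unique solution `P` for every `C`) if and
only if no eigenvalue `μ` of `A` and eigenvalue `ν` of `B` satisfy `μ + ν = 0`. -/
theorem sylvester_continuous_bijective_iff
    {n : Type*} [Fintype n] [DecidableEq n]
    (A B : Matrix n n ℂ) :
    Function.Bijective (fun P : Matrix n n ℂ => A * P + P * B) ↔
      ∀ μ ∈ spectrum ℂ A, ∀ ν ∈ spectrum ℂ B, μ + ν ≠ 0 := by
  constructor
  · intro h μ hμ ν hν hs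
    have hdet : ∀ (M : Matrix n n ℂ) (r : ℂ), r ∈ spectrum ℂ M →
        (algebraMap ℂ (Matrix n n ℂ) r - M).det = 0 := by
      intro M r hr
      rw [spectrum.mem_iff, Matrix.isUnit_iff_isUnit_det, isUnit_iff_ne_zero, not_not] at hr
      exact hr
    obtain ⟨v, hv, hv0⟩ := Matrix.exists_mulVec_eq_zero_iff.mpr (hdet A μ hμ)
    obtain ⟨w, hw, hw0⟩ := Matrix.exists_vecMul_eq_zero_iff.mpr (hdet B ν hν)
    have hAv : A *ᵥ v = μ • v := by
      rw [Matrix.sub_mulVec, sub_eq_zero, Algebra.algebraMap_eq_smul_one, Matrix.smul_mulVec,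
        Matrix.one_mulVec] at hv0
      exact hv0.symm
    have hBw : w ᵥ* B = ν • w := by
      rw [Matrix.vecMul_sub, sub_eq_zero, Algebra.algebraMap_eq_smul_one, Matrix.vecMul_smul,
        Matrix.vecMul_one] at hw0
      exact hw0.symm
    have h0 : vecMulVec v w = 0 := by
      apply h.1
      simp only [Matrix.mul_vecMulVec, Matrix.vecMulVec_mul, hAv, hBw, mul_zero, zero_mul,
        add_zero]
      ext i j
      simp only [Matrix.add_apply, Matrix.vecMulVec_apply, Pi.smul_apply, smul_eq_mul,
        Matrix.zero_apply]
      linear_combination (v i * w j) * hs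
    obtain ⟨i, hi⟩ := Function.ne_iff.mp hv
    obtain ⟨j, hj⟩ := Function.ne_iff.mp hw
    have := congrFun (congrFun h0 i) j
    rw [Matrix.vecMulVec_apply] at this
    exact mul_ne_zero hi hj this
  · intro h
    let L : Matrix n n ℂ →ₗ[ℂ] Matrix n n ℂ :=
      LinearMap.mulLeft ℂ A + LinearMap.mulRight ℂ B
    have hinj : Function.Injective L := by
      rw [injective_iff_map_eq_zero]
      intro P hP
      have hP' : A * P = P * (-B) := by
        have : A * P + P * B = 0 := hP
        rw [mul_neg]; exact eq_neg_of_add_eq_zero_left this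
      have key : ∀ p : Polynomial ℂ, Polynomial.aeval A p * P = P * Polynomial.aeval (-B) p := by
        intro p
        induction p using Polynomial.induction_on' with
        | add p q hp hq => rw [map_add, map_add, add_mul, mul_add, hp, hq]
        | monomial k a =>
          have hk : A ^ k * P = P * (-B) ^ k :=
            (SemiconjBy.pow_right (show SemiconjBy P (-B) A from hP'.symm) k).eq.symm
          rw [Polynomial.aeval_monomial, Polynomial.aeval_monomial, mul_assoc, hk,
            ← mul_assoc, Algebra.commutes, mul_assoc]
      have h1 := key A.charpoly
      rw [Matrix.aeval_self_charpoly, zero_mul] at h1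
      rcases isEmpty_or_nonempty n with hn | hn
      · exact Subsingleton.elim _ _
      have hu : IsUnit (Polynomial.aeval (-B) A.charpoly) := by
        by_contra hu
        rw [← spectrum.zero_mem_iff ℂ, spectrum.map_polynomial_aeval_of_nonempty _ _
          (spectrum.nonempty_of_isAlgClosed_of_finiteDimensional ℂ (-B))] at hu
        obtain ⟨μ, hμ, hr⟩ := hu
        rw [← spectrum.neg_eq, Set.mem_neg] at hμ
        exact h μ (Matrix.mem_spectrum_iff_isRoot_charpoly.mpr hr) (-μ) hμ (add_neg_cancel μ)
      exact (hu.mul_left_eq_zero).mp h1.symm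
    exact ⟨hinj, LinearMap.injective_iff_surjective.mp hinj⟩
end

section
/- Let A and B be n×n complex matrices. The linear map on n×n complex matrices given by P ↦ A·P·B − P is bijective (equivalently, for every C the discrete-time Sylvester equation A·P·B − P + C = 0 has a unique solution P) if and only if for every eigenvalue μ in the spectrum of A and every eigenvalue ν in the spectrum of B one has μ·ν ≠ 1. -/
open Matrix

/-- The discrete-time Sylvester operator `P ↦ A*P*B - P` on `n × n` complex matrices
is bijective (i.e. `A*P*B - P + C = 0` has a unique solution `P` for every `C`) if and
only if no eigenvalue `μ` of `A` and eigenvalue `ν` of `B` satisfy `μ * ν = 1`. -/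
theorem sylvester_discrete_bijective_iff
    {n : Type*} [Fintype n] [DecidableEq n]
    (A B : Matrix n n ℂ) :
    Function.Bijective (fun P : Matrix n n ℂ => A * P * B - P) ↔
      ∀ μ ∈ spectrum ℂ A, ∀ ν ∈ spectrum ℂ B, μ * ν ≠ 1 := by
  constructor
  · intro h μ hμ ν hν hμν
    rw [spectrum.mem_iff, Matrix.isUnit_iff_isUnit_det, isUnit_iff_ne_zero, not_not] at hμ hν
    obtain ⟨v, hv, hAv⟩ := Matrix.exists_mulVec_eq_zero_iff.2 hμ
    obtain ⟨w, hw, hBw⟩ := Matrix.exists_vecMul_eq_zero_iff.2 hν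
    rw [Matrix.sub_mulVec, sub_eq_zero, Algebra.algebraMap_eq_smul_one, Matrix.smul_mulVec,
      Matrix.one_mulVec] at hAv
    rw [Matrix.vecMul_sub, sub_eq_zero, Algebra.algebraMap_eq_smul_one, Matrix.vecMul_smul,
      Matrix.vecMul_one] at hBw
    have h0 : Matrix.vecMulVec v w = 0 := by
      apply h.1
      simp only [Matrix.mul_vecMulVec, Matrix.vecMulVec_mul, ← hAv, ← hBw]
      rw [Matrix.smul_vecMulVec, Matrix.vecMulVec_smul, smul_smul, hμν]
      simp
    obtain ⟨i, hi⟩ := Function.ne_iff.1 hv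
    obtain ⟨j, hj⟩ := Function.ne_iff.1 hw
    exact mul_ne_zero hi hj (congrFun (congrFun h0 i) j)
  · intro h
    let L : Matrix n n ℂ →ₗ[ℂ] Matrix n n ℂ :=
      LinearMap.mulRight ℂ B ∘ₗ LinearMap.mulLeft ℂ A - LinearMap.id
    have hL : ∀ P, L P = A * P * B - P := fun P => rfl
    suffices hi : Function.Injective L from
      ⟨hi, LinearMap.injective_iff_surjective.1 hi⟩
    rw [← LinearMap.ker_eq_bot]
    by_contra hne
    have hnt : Nontrivial (LinearMap.ker L) := Submodule.nontrivial_iff_ne_bot.2 hne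
    have hmaps : ∀ P ∈ LinearMap.ker L, LinearMap.mulLeft ℂ A P ∈ LinearMap.ker L := by
      intro P hP
      rw [LinearMap.mem_ker, hL] at hP ⊢
      rw [LinearMap.mulLeft_apply, Matrix.mul_assoc A (A * P) B, ← Matrix.mul_sub, hP,
        Matrix.mul_zero]
    obtain ⟨μ, hμ⟩ := Module.End.exists_eigenvalue ((LinearMap.mulLeft ℂ A).restrict hmaps)
    obtain ⟨⟨P, hP⟩, hev⟩ := hμ.exists_hasEigenvector
    have hP0 : P ≠ 0 := fun h0 => hev.2 (Subtype.ext h0)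
    have hAP : A * P = μ • P := congrArg Subtype.val hev.apply_eq_smul
    rw [LinearMap.mem_ker, hL, sub_eq_zero, hAP, Matrix.smul_mul] at hP
    have hμ0 : μ ≠ 0 := by
      rintro rfl
      exact hP0 (by rw [← hP, zero_smul])
    have hPB : P * B = μ⁻¹ • P := by
      conv_rhs => rw [← hP]
      rw [smul_smul, inv_mul_cancel₀ hμ0, one_smul]
    refine h μ ?_ μ⁻¹ ?_ (mul_inv_cancel₀ hμ0)
    · rw [spectrum.mem_iff]
      intro hu
      apply hP0
      apply hu.mul_left_cancel
      rw [mul_zero, sub_mul, hAP, Algebra.algebraMap_eq_smul_one, smul_mul_assoc, one_mul, sub_self]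
    · rw [spectrum.mem_iff]
      intro hu
      apply hP0
      apply hu.mul_right_cancel
      rw [zero_mul, mul_sub, hPB, Algebra.algebraMap_eq_smul_one, mul_smul_comm, mul_one, sub_self]
end

section
/- Let A, Q, P be n×n real matrices. Suppose every eigenvalue μ (in ℂ) of A, i.e., every element of the spectrum of the complexification of A, has strictly negative real part (A is Hurwitz), Q is positive semi-definite, and P satisfies the continuous-time Lyapunov equation A·P + P·Aᵀ + Q = 0. Then P is positive semi-definite. -/
open Matrix

section aux
open Filter Topology
open scoped NNReal ENNReal

theorem aux_pow_tendsto {R : Type*} [NormedRing R] [NormedAlgebra ℂ R] [CompleteSpace R]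
    [Nontrivial R] (a : R) (h : ∀ z ∈ spectrum ℂ a, ‖z‖ < 1) :
    Tendsto (fun k : ℕ => a ^ k) atTop (𝓝 0) := by
  have h1 : spectralRadius ℂ a < (1 : ℝ≥0) :=
    spectrum.spectralRadius_lt_of_forall_lt a (fun z hz => by
      have := h z hz
      exact_mod_cast this)
  obtain ⟨r, hr1, hr2⟩ := ENNReal.lt_iff_exists_nnreal_btwn.1 h1
  have h2 := (spectrum.pow_nnnorm_pow_one_div_tendsto_nhds_spectralRadius a).eventually
    (gt_mem_nhds hr1)
  have hr : (r : ℝ) < 1 := by exact_mod_cast hr2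
  refine squeeze_zero_norm' (a := fun k : ℕ => (r : ℝ) ^ k) ?_
    (tendsto_pow_atTop_nhds_zero_of_lt_one r.2 hr)
  filter_upwards [h2, eventually_gt_atTop 0] with k hk hk0
  have hk' : (0 : ℝ) < k := by exact_mod_cast hk0
  have h3 := ENNReal.rpow_le_rpow hk.le hk'.le
  rw [← ENNReal.rpow_mul, one_div, inv_mul_cancel₀ hk'.ne', ENNReal.rpow_one,
    ENNReal.rpow_natCast] at h3
  exact_mod_cast h3

attribute [local instance] Matrix.linftyOpNormedRing Matrix.linftyOpNormedAlgebra in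
theorem aux_mat_tendsto {n : Type*} [Fintype n] [DecidableEq n]
    (B : Matrix n n ℝ) (h : ∀ z ∈ spectrum ℂ (B.map (algebraMap ℝ ℂ)), ‖z‖ < 1) (i j : n) :
    Tendsto (fun k : ℕ => (B ^ k) i j) atTop (𝓝 0) := by
  have : Nonempty n := ⟨i⟩
  have h1 : Tendsto (fun k : ℕ => (B.map (algebraMap ℝ ℂ)) ^ k) atTop (𝓝 0) :=
    aux_pow_tendsto _ h
  have h2 : Tendsto (fun k : ℕ => ((B.map (algebraMap ℝ ℂ)) ^ k) i j) atTop (𝓝 0) :=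
    ((continuous_id.matrix_elem i j).tendsto (0 : Matrix n n ℂ)).comp h1
  have h3 := (Complex.continuous_re.tendsto _).comp h2
  refine h3.congr fun k => ?_
  have : (B.map (algebraMap ℝ ℂ)) ^ k = (B ^ k).map (algebraMap ℝ ℂ) :=
    (map_pow (algebraMap ℝ ℂ).mapMatrix B k).symm
  rw [Function.comp_apply, this]
  simp

theorem aux_cayley {l : ℂ} (h1 : l ≠ -1) (h : ((l - 1) / (l + 1)).re < 0) : ‖l‖ < 1 := by
  have h0 : l + 1 ≠ 0 := fun h => h1 (eq_neg_of_add_eq_zero_left h)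
  have hp := Complex.normSq_pos.2 h0
  rw [Complex.div_re, ← add_div, div_neg_iff] at h
  rcases h with h | h
  · exact absurd h.2 (not_lt.2 hp.le)
  · have h2 := h.1
    have : ‖l‖ ^ 2 < 1 := by
      rw [Complex.sq_norm, Complex.normSq_apply]
      simp at h2
      nlinarith
    nlinarith [norm_nonneg l]

end aux

/-- If `A` is Hurwitz (every complex eigenvalue of its complexification has strictly
negative real part), `Q` is positive semi-definite, and `P` solves the continuous-time
Lyapunov equation `A*P + P*Aᵀ + Q = 0`, then `P` is positive semi-definite. -/
theorem lyapunov_continuous_posSemidef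
    {n : Type*} [Fintype n] [DecidableEq n]
    (A Q P : Matrix n n ℝ)
    (hA : ∀ μ ∈ spectrum ℂ (A.map (algebraMap ℝ ℂ)), μ.re < 0)
    (hQ : Q.PosSemidef)
    (hP : A * P + P * Aᵀ + Q = 0) :
    P.PosSemidef := by
  have hmap : ∀ M : Matrix n n ℝ, M.map (algebraMap ℝ ℂ) = (algebraMap ℝ ℂ).mapMatrix M :=
    fun _ => rfl
  have hu : IsUnit (1 - A) := by
    have h1 : (1 : ℂ) ∉ spectrum ℂ (A.map (algebraMap ℝ ℂ)) := fun h => by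
      have := hA 1 h
      norm_num at this
    rw [spectrum.notMem_iff, map_one, hmap, ← map_one (algebraMap ℝ ℂ).mapMatrix, ← map_sub,
      Matrix.isUnit_iff_isUnit_det, ← RingHom.map_det, isUnit_iff_ne_zero] at h1
    rw [Matrix.isUnit_iff_isUnit_det, isUnit_iff_ne_zero]
    intro h
    exact h1 (by rw [h, map_zero])
  obtain ⟨u, hu'⟩ := hu
  set R : Matrix n n ℝ := ((u⁻¹ : (Matrix n n ℝ)ˣ) : Matrix n n ℝ) with hR
  have hR1 : R * (1 - A) = 1 := by rw [← hu', hR]; simp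
  have hR2 : (1 - A) * R = 1 := by rw [← hu', hR]; simp
  set B := R * (1 + A) with hB
  have hspec : ∀ z ∈ spectrum ℂ (B.map (algebraMap ℝ ℂ)), ‖z‖ < 1 := by
    intro z hz
    set f := (algebraMap ℝ ℂ).mapMatrix (m := n) with hf
    have e1 : f R * (1 - f A) = 1 := by rw [← map_one f, ← map_sub, ← map_mul, hR1]
    have e2 : (1 - f A) * f R = 1 := by rw [← map_one f, ← map_sub, ← map_mul, hR2]
    have e3 : f B = f R * (1 + f A) := by rw [hB, map_mul, map_add, map_one]
    have key : algebraMap ℂ _ z - f B = f R * ((z - 1) • (1 : Matrix n n ℂ) - (z + 1) • f A) := by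
      have : (z - 1) • (1 : Matrix n n ℂ) - (z + 1) • f A = z • (1 - f A) - (1 + f A) := by
        module
      rw [this, mul_sub, mul_smul_comm, e1, e3, Algebra.algebraMap_eq_smul_one]
    have hRu : IsUnit (f R) := ⟨⟨f R, 1 - f A, e1, e2⟩, rfl⟩
    rw [hmap, spectrum.mem_iff, key] at hz
    have hz' : ¬ IsUnit ((z - 1) • (1 : Matrix n n ℂ) - (z + 1) • f A) :=
      fun h => hz (hRu.mul h)
    have hz1 : z ≠ -1 := by
      rintro rfl
      apply hz'
      have : ((-1 : ℂ) - 1) • (1 : Matrix n n ℂ) - ((-1 : ℂ) + 1) • f A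
          = algebraMap ℂ _ (-2 : ℂ) := by
        rw [Algebra.algebraMap_eq_smul_one]; norm_num
      rw [this]
      exact (isUnit_iff_ne_zero.2 (by norm_num)).map _
    have h0 : z + 1 ≠ 0 := fun h => hz1 (eq_neg_of_add_eq_zero_left h)
    refine aux_cayley hz1 (hA _ ?_)
    rw [spectrum.mem_iff]
    intro h
    apply hz'
    have : (z - 1) • (1 : Matrix n n ℂ) - (z + 1) • f A
        = algebraMap ℂ _ (z + 1) * (algebraMap ℂ _ ((z - 1) / (z + 1)) - f A) := by
      rw [← Algebra.smul_def, smul_sub, Algebra.algebraMap_eq_smul_one, smul_smul,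
        mul_div_cancel₀ _ h0]
    rw [this]
    exact ((isUnit_iff_ne_zero.2 h0).map _).mul h
  have hRt : (1 - A)ᵀ * Rᵀ = 1 := by rw [← transpose_mul, hR1, transpose_one]
  have hstein : P - B * P * Bᵀ = R * (Q + Q) * Rᵀ := by
    have e : P = R * ((1 - A) * P * (1 - A)ᵀ) * Rᵀ := by
      calc P = (R * (1 - A)) * P * ((1 - A)ᵀ * Rᵀ) := by rw [hR1, hRt]; simp
        _ = _ := by simp only [mul_assoc]
    have e' : B * P * Bᵀ = R * ((1 + A) * P * (1 + A)ᵀ) * Rᵀ := by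
      rw [hB, transpose_mul]; simp only [mul_assoc]
    have hQ' : Q = -(A * P + P * Aᵀ) := (neg_eq_of_add_eq_zero_right hP).symm
    rw [e']
    nth_rewrite 1 [e]
    rw [← sub_mul, ← mul_sub, hQ']
    congr 2
    simp only [transpose_sub, transpose_add, transpose_one]
    noncomm_ring
  have h1 : (P - B * P * Bᵀ).PosSemidef := by
    rw [hstein]
    simpa using (hQ.add hQ).mul_mul_conjTranspose_same R
  have hk : ∀ k : ℕ, (P - B ^ k * P * (B ^ k)ᵀ).PosSemidef := by
    intro k
    induction k with
    | zero => simpa using PosSemidef.zero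
    | succ k ih =>
      have := h1.add (ih.mul_mul_conjTranspose_same B)
      convert this using 1
      rw [pow_succ', transpose_mul, conjTranspose_eq_transpose_of_trivial]
      noncomm_ring
  have hlim : Filter.Tendsto (fun k : ℕ => P - B ^ k * P * (B ^ k)ᵀ) Filter.atTop (nhds P) := by
    have hB0 : Filter.Tendsto (fun k : ℕ => B ^ k) Filter.atTop (nhds 0) :=
      tendsto_pi_nhds.2 fun i => tendsto_pi_nhds.2 fun j => aux_mat_tendsto B hspec i j
    have hc : Continuous fun X : Matrix n n ℝ => P - X * P * Xᵀ := by fun_prop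
    have := (hc.tendsto 0).comp hB0
    simpa [Function.comp_def] using this
  refine PosSemidef.of_dotProduct_mulVec_nonneg ?_ fun x => ?_
  · have hc : Continuous fun X : Matrix n n ℝ => Xᴴ := by fun_prop
    exact tendsto_nhds_unique (((hc.tendsto P).comp hlim).congr fun k => (hk k).1) hlim
  · have hc : Continuous fun X : Matrix n n ℝ => star x ⬝ᵥ (X *ᵥ x) := by fun_prop
    exact ge_of_tendsto' ((hc.tendsto P).comp hlim) fun k => (hk k).dotProduct_mulVec_nonneg x
end
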